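/- Let A be a densely defined closed linear operator on a complex Banach space X that is sectorial of some angle θ < π/2 and satisfies 0 ∈ ρ(A). Then for each nonnegative integer α and each pair 0 < ω_min ≤ ω_max < ∞ there exists a constant M > 0 such that ‖(∏_{k=1}^n V_{ω_k}(A)) A^{-α}‖ ≤ M n^{-α} for all n ∈ ℕ and all sequences (ω_k)_{k∈ℕ} ∈ S(ω_min, ω_max). -/

import Mathlib

open Filter Topology

noncomputable section

variable {X : Type*} [NormedAddCommGroup X] [NormedSpace ℂ X]

/-- `R` is a (two-sided) bounded inverse of the operator `lam + A`, so `R = (lam + A)⁻¹`. -/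
def IsResolventAt (A : X →ₗ.[ℂ] X) (lam : ℂ) (R : X →L[ℂ] X) : Prop :=
  (∀ x : X, ∃ hx : R x ∈ A.domain, lam • R x + A ⟨R x, hx⟩ = x) ∧
  ∀ x : A.domain, R (lam • (x : X) + A x) = (x : X)

/-- The open sector `Σ_θ = {z ≠ 0 : |arg z| < θ}` (for `θ > 0`). -/
def sector (θ : ℝ) : Set ℂ := {z : ℂ | z ≠ 0 ∧ |Complex.arg z| < θ}

/-- `A` is sectorial of angle `θ ∈ (0, π)`: the spectrum of `A` is contained in the closed
sector `closure Σ_θ` (i.e. every `lam` outside it belongs to the resolvent set of `A`),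
and for every `θ' ∈ (θ, π)` the family `lam (lam - A)⁻¹ = -lam ((-lam) + A)⁻¹` is uniformly
bounded outside `closure Σ_{θ'}`. -/
def IsSectorialOfAngle (A : X →ₗ.[ℂ] X) (θ : ℝ) : Prop :=
  (∀ lam : ℂ, lam ∉ closure (sector θ) → ∃ R : X →L[ℂ] X, IsResolventAt A (-lam) R) ∧
  ∀ θ' : ℝ, θ < θ' → θ' < Real.pi →
    ∃ C : ℝ, ∀ lam : ℂ, lam ∉ closure (sector θ') →
      ∀ R : X →L[ℂ] X, IsResolventAt A (-lam) R → ‖lam • R‖ ≤ C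

/-- The integral of `f` along the oriented segment from `p` to `q`. -/
def segmentIntegral {E : Type*} [NormedAddCommGroup E] [NormedSpace ℂ E]
    (f : ℂ → E) (p q : ℂ) : E :=
  ∫ t in (0 : ℝ)..1, (q - p) • f (p + t • (q - p))

/-- The integral of `f` along the oriented boundary of the triangle with vertices `a`, `b`, `c`. -/
def triangleIntegral {E : Type*} [NormedAddCommGroup E] [NormedSpace ℂ E]
    (f : ℂ → E) (a b c : ℂ) : E :=
  segmentIntegral f a b + segmentIntegral f b c - segmentIntegral f a c

/-- The union of the three sides of the triangle with vertices `a`, `b`, `c`. -/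
def triangleBoundary (a b c : ℂ) : Set ℂ :=
  segment ℝ a b ∪ segment ℝ b c ∪ segment ℝ a c

section Integral

variable {E : Type*} [NormedAddCommGroup E] [NormedSpace ℂ E]

lemma add_smul_sub_mem_segment (p q : ℂ) {t : ℝ} (ht : t ∈ Set.Icc (0 : ℝ) 1) :
    p + t • (q - p) ∈ segment ℝ p q := by
  rw [segment_eq_image']
  exact ⟨t, ht, rfl⟩

lemma continuousOn_comp_segment {Y : Type*} [TopologicalSpace Y] {f : ℂ → Y} {p q : ℂ}
    (hf : ContinuousOn f (segment ℝ p q)) :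
    ContinuousOn (fun t : ℝ => f (p + t • (q - p))) (Set.Icc 0 1) :=
  hf.comp (by fun_prop) fun _ ht => add_smul_sub_mem_segment p q ht

lemma intervalIntegrable_segment {f : ℂ → E} {p q : ℂ} (hf : ContinuousOn f (segment ℝ p q)) :
    IntervalIntegrable (fun t : ℝ => (q - p) • f (p + t • (q - p))) MeasureTheory.volume 0 1 :=
  ((continuousOn_comp_segment hf).const_smul (q - p)).intervalIntegrable_of_Icc zero_le_one

lemma segmentIntegral_congr {f g : ℂ → E} {p q : ℂ} (h : Set.EqOn f g (segment ℝ p q)) :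
    segmentIntegral f p q = segmentIntegral g p q := by
  refine intervalIntegral.integral_congr fun t ht => ?_
  rw [Set.uIcc_of_le zero_le_one] at ht
  simp only [h (add_smul_sub_mem_segment p q ht)]

lemma segmentIntegral_add {f g : ℂ → E} {p q : ℂ} (hf : ContinuousOn f (segment ℝ p q))
    (hg : ContinuousOn g (segment ℝ p q)) :
    segmentIntegral (fun z => f z + g z) p q = segmentIntegral f p q + segmentIntegral g p q := by
  simp only [segmentIntegral, smul_add]
  exact intervalIntegral.integral_add (intervalIntegrable_segment hf)
    (intervalIntegrable_segment hg)

lemma segmentIntegral_clm_comp [CompleteSpace E] {F : Type*} [NormedAddCommGroup F]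
    [NormedSpace ℂ F] [CompleteSpace F] (L : E →L[ℂ] F) {f : ℂ → E} {p q : ℂ}
    (hf : ContinuousOn f (segment ℝ p q)) :
    segmentIntegral (fun z => L (f z)) p q = L (segmentIntegral f p q) := by
  simp only [segmentIntegral, ← map_smul]
  exact L.intervalIntegral_comp_comm (intervalIntegrable_segment hf)

lemma norm_segmentIntegral_le {f : ℂ → E} {p q : ℂ} {M : ℝ}
    (h : ∀ z ∈ segment ℝ p q, ‖f z‖ ≤ M) : ‖segmentIntegral f p q‖ ≤ M * ‖q - p‖ := by
  have := intervalIntegral.norm_integral_le_of_norm_le_const (a := 0) (b := 1)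
    (f := fun t : ℝ => (q - p) • f (p + t • (q - p))) (C := M * ‖q - p‖) fun t ht => by
      rw [Set.uIoc_of_le zero_le_one] at ht
      rw [norm_smul, mul_comm]
      exact mul_le_mul_of_nonneg_right
        (h _ (add_smul_sub_mem_segment p q ⟨ht.1.le, ht.2⟩)) (norm_nonneg _)
  simpa [segmentIntegral] using this

lemma segmentIntegral_eq_sub [CompleteSpace E] {f F : ℂ → E} {p q : ℂ}
    (hf : ContinuousOn f (segment ℝ p q))
    (hF : ∀ z ∈ segment ℝ p q, HasDerivAt F (f z) z) :
    segmentIntegral f p q = F q - F p := by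
  have := intervalIntegral.integral_unitInterval_deriv_eq_sub (continuousOn_comp_segment hf)
    fun t ht => hF _ (add_smul_sub_mem_segment p q ht)
  rw [segmentIntegral, intervalIntegral.integral_smul, this, add_sub_cancel]

variable {a b c : ℂ}

lemma triangleIntegral_congr {f g : ℂ → E} (h : Set.EqOn f g (triangleBoundary a b c)) :
    triangleIntegral f a b c = triangleIntegral g a b c := by
  simp only [triangleIntegral,
    segmentIntegral_congr (h.mono fun _ hz => Or.inl (Or.inl hz)),
    segmentIntegral_congr (h.mono fun _ hz => Or.inl (Or.inr hz)),
    segmentIntegral_congr (h.mono fun _ hz => Or.inr hz)]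

lemma triangleIntegral_add {f g : ℂ → E} (hf : ContinuousOn f (triangleBoundary a b c))
    (hg : ContinuousOn g (triangleBoundary a b c)) :
    triangleIntegral (fun z => f z + g z) a b c =
      triangleIntegral f a b c + triangleIntegral g a b c := by
  simp only [triangleIntegral,
    segmentIntegral_add (hf.mono fun _ hz => Or.inl (Or.inl hz))
      (hg.mono fun _ hz => Or.inl (Or.inl hz)),
    segmentIntegral_add (hf.mono fun _ hz => Or.inl (Or.inr hz))
      (hg.mono fun _ hz => Or.inl (Or.inr hz)),
    segmentIntegral_add (hf.mono fun _ hz => Or.inr hz) (hg.mono fun _ hz => Or.inr hz)]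
  abel

lemma triangleIntegral_clm_comp [CompleteSpace E] {F : Type*} [NormedAddCommGroup F]
    [NormedSpace ℂ F] [CompleteSpace F] (L : E →L[ℂ] F) {f : ℂ → E}
    (hf : ContinuousOn f (triangleBoundary a b c)) :
    triangleIntegral (fun z => L (f z)) a b c = L (triangleIntegral f a b c) := by
  simp only [triangleIntegral, map_add, map_sub,
    segmentIntegral_clm_comp L (hf.mono fun _ hz => Or.inl (Or.inl hz)),
    segmentIntegral_clm_comp L (hf.mono fun _ hz => Or.inl (Or.inr hz)),
    segmentIntegral_clm_comp L (hf.mono fun _ hz => Or.inr hz)]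

lemma norm_triangleIntegral_le {f : ℂ → E} {M : ℝ}
    (h : ∀ z ∈ triangleBoundary a b c, ‖f z‖ ≤ M) :
    ‖triangleIntegral f a b c‖ ≤ M * (‖b - a‖ + ‖c - b‖ + ‖c - a‖) := by
  refine (norm_sub_le_of_le (norm_add_le_of_le
    (norm_segmentIntegral_le fun z hz => h z (Or.inl (Or.inl hz)))
    (norm_segmentIntegral_le fun z hz => h z (Or.inl (Or.inr hz))))
    (norm_segmentIntegral_le fun z hz => h z (Or.inr hz))).trans_eq ?_
  ring

lemma triangleIntegral_eq_zero_of_hasDerivAt [CompleteSpace E] {f F : ℂ → E}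
    (hf : ContinuousOn f (triangleBoundary a b c))
    (hF : ∀ z ∈ triangleBoundary a b c, HasDerivAt F (f z) z) :
    triangleIntegral f a b c = 0 := by
  rw [triangleIntegral,
    segmentIntegral_eq_sub (hf.mono fun _ hz => Or.inl (Or.inl hz))
      fun z hz => hF z (Or.inl (Or.inl hz)),
    segmentIntegral_eq_sub (hf.mono fun _ hz => Or.inl (Or.inr hz))
      fun z hz => hF z (Or.inl (Or.inr hz)),
    segmentIntegral_eq_sub (hf.mono fun _ hz => Or.inr hz) fun z hz => hF z (Or.inr hz)]
  abel

lemma triangleBoundary_subset {s : Set ℂ} (hs : Convex ℝ s) (ha : a ∈ s) (hb : b ∈ s)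
    (hc : c ∈ s) : triangleBoundary a b c ⊆ s :=
  Set.union_subset (Set.union_subset (hs.segment_subset ha hb) (hs.segment_subset hb hc))
    (hs.segment_subset ha hc)

/-- Cauchy's theorem for triangles in an open convex set. -/
lemma triangleIntegral_eq_zero_of_differentiableOn [CompleteSpace E] {f : ℂ → E} {s : Set ℂ}
    (hs : Convex ℝ s) (hso : IsOpen s) (hf : DifferentiableOn ℂ f s) (ha : a ∈ s) (hb : b ∈ s)
    (hc : c ∈ s) : triangleIntegral f a b c = 0 := by
  obtain ⟨F, hF⟩ := hs.exists_forall_hasDerivWithinAt hf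
  have hsub := triangleBoundary_subset hs ha hb hc
  exact triangleIntegral_eq_zero_of_hasDerivAt (hf.continuousOn.mono hsub)
    fun z hz => (hF z (hsub hz)).hasDerivAt (hso.mem_nhds (hsub hz))

end Integral

section Resolvent

variable {𝔸 : Type*} [NormedRing 𝔸] [NormedAlgebra ℂ 𝔸]

lemma sub_mul_resolvent {B : 𝔸} {z : ℂ} (hz : z ∈ resolventSet ℂ B) :
    (algebraMap ℂ 𝔸 z - B) * resolvent B z = 1 :=
  Ring.mul_inverse_cancel _ hz

lemma resolvent_mul_sub {B : 𝔸} {z : ℂ} (hz : z ∈ resolventSet ℂ B) :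
    resolvent B z * (algebraMap ℂ 𝔸 z - B) = 1 :=
  Ring.inverse_mul_cancel _ hz

lemma commute_resolvent_smul {B : 𝔸} {s : ℝ} {z : ℂ} (hz : z ∈ resolventSet ℂ (s • B)) :
    Commute B (resolvent (s • B) z) := by
  have h1 : Commute B (algebraMap ℂ 𝔸 z - s • B) :=
    Commute.sub_right (Algebra.commutes z B).symm ((Commute.refl B).smul_right s)
  calc B * resolvent (s • B) z
      = resolvent (s • B) z * (algebraMap ℂ 𝔸 z - s • B) * B * resolvent (s • B) z := by
        rw [resolvent_mul_sub hz, one_mul]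
    _ = resolvent (s • B) z * B := by
        rw [mul_assoc (resolvent (s • B) z), ← h1.eq, ← mul_assoc, mul_assoc _ _
          (resolvent (s • B) z), sub_mul_resolvent hz, mul_one]

lemma resolvent_smul_sub_resolvent_smul {B : 𝔸} {s t : ℝ} {z : ℂ}
    (hs : z ∈ resolventSet ℂ (s • B)) (ht : z ∈ resolventSet ℂ (t • B)) :
    resolvent (s • B) z - resolvent (t • B) z =
      (s - t) • (resolvent (s • B) z * B * resolvent (t • B) z) := by
  have h3 : (s - t) • B = (algebraMap ℂ 𝔸 z - t • B) - (algebraMap ℂ 𝔸 z - s • B) := by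
    module
  rw [← smul_mul_assoc, ← mul_smul_comm, h3, mul_sub, resolvent_mul_sub hs, sub_mul, mul_assoc,
    sub_mul_resolvent ht]
  simp

/-- Second order expansion of the resolvent of `s • B` in the parameter `s`. -/
lemma resolvent_smul_eq_add_add {B : 𝔸} {s t : ℝ} {z : ℂ}
    (hs : z ∈ resolventSet ℂ (s • B)) (ht : z ∈ resolventSet ℂ (t • B)) :
    resolvent (s • B) z = resolvent (t • B) z +
      (s - t) • (resolvent (s • B) z * B * resolvent (s • B) z) +
      -(s - t) ^ 2 •
        (resolvent (s • B) z * B * (resolvent (s • B) z * B * resolvent (t • B) z)) := by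
  have hst := resolvent_smul_sub_resolvent_smul hs ht
  have : resolvent (s • B) z * B * resolvent (t • B) z =
      resolvent (s • B) z * B * resolvent (s • B) z -
      (s - t) • (resolvent (s • B) z * B *
        (resolvent (s • B) z * B * resolvent (t • B) z)) := by
    rw [← mul_smul_comm, ← mul_sub, ← hst, sub_sub_cancel]
  rw [this, sub_eq_iff_eq_add] at hst
  conv_lhs => rw [hst]
  module

variable [CompleteSpace 𝔸]

lemma continuousOn_resolvent {B : 𝔸} {s : Set ℂ} (hs : s ⊆ resolventSet ℂ B) :
    ContinuousOn (resolvent B) s := fun _ hz =>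
  (spectrum.hasDerivAt_resolvent_const_left (hs hz)).continuousAt.continuousWithinAt

variable {a b c : ℂ}

/-- The holomorphic calculus sends multiplication by `z` to multiplication by `B`. -/
lemma triangleIntegral_mul_smul_resolvent {B : 𝔸} {g : ℂ → ℂ}
    (hB : triangleBoundary a b c ⊆ resolventSet ℂ B)
    (hg : ContinuousOn g (triangleBoundary a b c)) (hg0 : triangleIntegral g a b c = 0) :
    triangleIntegral (fun z => (z * g z) • resolvent B z) a b c =
      triangleIntegral (fun z => g z • resolvent B z) a b c * B := by
  have hR : ContinuousOn (fun z => g z • resolvent B z) (triangleBoundary a b c) :=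
    hg.smul (continuousOn_resolvent hB)
  have key : Set.EqOn (fun z => (z * g z) • resolvent B z)
      (fun z => (ContinuousLinearMap.mul ℂ 𝔸).flip B (g z • resolvent B z) +
        (ContinuousLinearMap.id ℂ ℂ).smulRight (1 : 𝔸) (g z)) (triangleBoundary a b c) := by
    intro z hz
    have h1 := resolvent_mul_sub (hB hz)
    rw [mul_sub, ← Algebra.commutes, ← Algebra.smul_def, sub_eq_iff_eq_add] at h1
    simp only [ContinuousLinearMap.flip_apply, ContinuousLinearMap.mul_apply',
      ContinuousLinearMap.smulRight_apply, ContinuousLinearMap.id_apply]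
    rw [mul_comm, mul_smul, h1, smul_add, smul_mul_assoc, add_comm]
  rw [triangleIntegral_congr key, triangleIntegral_add, triangleIntegral_clm_comp _ hR,
    triangleIntegral_clm_comp _ hg, hg0]
  · simp
  · exact (ContinuousLinearMap.continuous _).comp_continuousOn hR
  · exact (ContinuousLinearMap.continuous _).comp_continuousOn hg

lemma eq_of_norm_sub_le_sq {E : Type*} [NormedAddCommGroup E] {G : ℝ → E} {M : ℝ}
    (h : ∀ s ∈ Set.Icc (0 : ℝ) 1, ∀ t ∈ Set.Icc (0 : ℝ) 1, ‖G s - G t‖ ≤ M * (s - t) ^ 2) :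
    G 1 = G 0 := by
  have hbound (N : ℕ) : ‖G 1 - G 0‖ ≤ M / ((N : ℝ) + 1) := by
    have hN : (0 : ℝ) < (N : ℝ) + 1 := by positivity
    have hmem (i : ℕ) (hi : i ≤ N + 1) : (i : ℝ) / ((N : ℝ) + 1) ∈ Set.Icc (0 : ℝ) 1 :=
      ⟨by positivity, (div_le_one hN).2 (by exact_mod_cast hi)⟩
    have hsum := Finset.sum_range_sub (fun i : ℕ => G ((i : ℝ) / ((N : ℝ) + 1))) (N + 1)
    simp only [Nat.cast_zero, zero_div, Nat.cast_add, Nat.cast_one, div_self hN.ne'] at hsum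
    rw [← hsum]
    refine (norm_sum_le_of_le _ (f := fun i : ℕ =>
      G (((i : ℝ) + 1) / ((N : ℝ) + 1)) - G ((i : ℝ) / ((N : ℝ) + 1)))
      (n := fun _ => M / ((N : ℝ) + 1) ^ 2) fun i hi => ?_).trans_eq ?_
    · have hi' := Finset.mem_range.1 hi
      refine (h _ (by exact_mod_cast hmem (i + 1) hi') _ (hmem i hi'.le)).trans_eq ?_
      field_simp
      ring
    · simp
      field_simp
  have hlim : Tendsto (fun N : ℕ => M / ((N : ℝ) + 1)) atTop (𝓝 0) := by
    simpa [div_eq_mul_inv] using (tendsto_one_div_add_atTop_nhds_zero_nat (𝕜 := ℝ)).const_mul M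
  have := ge_of_tendsto' hlim hbound
  exact sub_eq_zero.1 (norm_le_zero_iff.1 this)

/-- The holomorphic calculus of the constant function `1`, by contracting `B` to `0`. -/
lemma triangleIntegral_resolvent {B : 𝔸} {C : ℝ}
    (h0 : (0 : ℂ) ∉ triangleBoundary a b c)
    (hB : ∀ σ ∈ Set.Icc (0 : ℝ) 1, triangleBoundary a b c ⊆ resolventSet ℂ (σ • B))
    (hC : ∀ σ ∈ Set.Icc (0 : ℝ) 1, ∀ z ∈ triangleBoundary a b c, ‖resolvent (σ • B) z‖ ≤ C) :
    triangleIntegral (resolvent B) a b c =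
      triangleIntegral (fun z => z⁻¹) a b c • (1 : 𝔸) := by
  have hconst : triangleIntegral (resolvent ((1 : ℝ) • B)) a b c =
      triangleIntegral (resolvent ((0 : ℝ) • B)) a b c := by
    refine eq_of_norm_sub_le_sq (G := fun σ => triangleIntegral (resolvent (σ • B)) a b c)
      (M := C * ‖B‖ * (C * ‖B‖ * C) * (‖b - a‖ + ‖c - b‖ + ‖c - a‖)) fun s hs t ht => ?_
    have hs' := continuousOn_resolvent (hB s hs)
    have ht' := continuousOn_resolvent (hB t ht)
    have hsB : ContinuousOn (fun z => resolvent (s • B) z * B) (triangleBoundary a b c) :=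
      hs'.mul continuousOn_const
    have hfirst : triangleIntegral
        (fun z => (s - t) • (resolvent (s • B) z * B * resolvent (s • B) z)) a b c = 0 := by
      refine triangleIntegral_eq_zero_of_hasDerivAt
        (F := fun z => (s - t) • -(resolvent (s • B) z * B))
        ((hsB.mul hs').const_smul _) fun z hz => ?_
      refine HasDerivAt.const_smul (s - t) ?_
      convert! ((spectrum.hasDerivAt_resolvent_const_left (hB s hs hz)).mul_const B).neg using 1
      rw [mul_assoc, (commute_resolvent_smul (hB s hs hz)).eq]
      noncomm_ring
    have hrem : ∀ z ∈ triangleBoundary a b c, ‖-(s - t) ^ 2 •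
        (resolvent (s • B) z * B * (resolvent (s • B) z * B * resolvent (t • B) z))‖ ≤
          (s - t) ^ 2 * (C * ‖B‖ * (C * ‖B‖ * C)) := by
      intro z hz
      rw [norm_smul, norm_neg, Real.norm_of_nonneg (sq_nonneg _)]
      have h1 := hC s hs z hz
      have h2 := hC t ht z hz
      have h3 : ‖resolvent (s • B) z * B‖ ≤ C * ‖B‖ := norm_mul_le_of_le h1 le_rfl
      exact mul_le_mul_of_nonneg_left
        (norm_mul_le_of_le h3 (norm_mul_le_of_le h3 h2)) (sq_nonneg _)
    have hdiff : triangleIntegral (resolvent (s • B)) a b c =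
        triangleIntegral (resolvent (t • B)) a b c + triangleIntegral (fun z => -(s - t) ^ 2 •
        (resolvent (s • B) z * B * (resolvent (s • B) z * B * resolvent (t • B) z))) a b c := by
      have hlin : ContinuousOn (fun z => (s - t) •
          (resolvent (s • B) z * B * resolvent (s • B) z)) (triangleBoundary a b c) :=
        (hsB.mul hs').const_smul _
      have hquad : ContinuousOn (fun z => -(s - t) ^ 2 •
          (resolvent (s • B) z * B * (resolvent (s • B) z * B * resolvent (t • B) z)))
          (triangleBoundary a b c) := (hsB.mul (hsB.mul ht')).const_smul _
      rw [triangleIntegral_congr fun z hz => resolvent_smul_eq_add_add (hB s hs hz) (hB t ht hz),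
        triangleIntegral_add (ht'.fun_add hlin) hquad, triangleIntegral_add ht' hlin, hfirst, add_zero]
    simp only [hdiff, add_sub_cancel_left]
    refine (norm_triangleIntegral_le hrem).trans_eq ?_
    ring
  have hinv : ContinuousOn (fun z : ℂ => z⁻¹) (triangleBoundary a b c) :=
    continuousOn_inv₀.mono fun z hz h => h0 (h ▸ hz)
  have hzero : Set.EqOn (resolvent ((0 : ℝ) • B))
      (fun z => (ContinuousLinearMap.id ℂ ℂ).smulRight (1 : 𝔸) (z⁻¹))
      (triangleBoundary a b c) := by
    intro z hz
    have hz0 : z ≠ 0 := fun h => h0 (h ▸ hz)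
    have h := resolvent_mul_sub (hB 0 (by simp) hz)
    rw [zero_smul, sub_zero, ← Algebra.commutes, ← Algebra.smul_def] at h
    simp [← h, smul_smul, hz0]
  rw [one_smul] at hconst
  rw [hconst, triangleIntegral_congr hzero, triangleIntegral_clm_comp _ hinv]
  simp

end Resolvent

section Calculus

variable {𝔸 : Type*} [NormedRing 𝔸] [NormedAlgebra ℂ 𝔸] [CompleteSpace 𝔸] {a b c : ℂ}

lemma triangleIntegral_one_add_mul_smul_resolvent {B : 𝔸} {g : ℂ → ℂ} (μ : ℂ)
    (hB : triangleBoundary a b c ⊆ resolventSet ℂ B)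
    (hg : ContinuousOn g (triangleBoundary a b c)) (hg0 : triangleIntegral g a b c = 0) :
    triangleIntegral (fun z => ((1 + μ * z) * g z) • resolvent B z) a b c =
      triangleIntegral (fun z => g z • resolvent B z) a b c * (1 + μ • B) := by
  have hR : ContinuousOn (fun z => g z • resolvent B z) (triangleBoundary a b c) :=
    hg.smul (continuousOn_resolvent hB)
  have hzR : ContinuousOn (fun z => (z * g z) • resolvent B z) (triangleBoundary a b c) :=
    (continuousOn_id.mul hg).smul (continuousOn_resolvent hB)
  have hμ : ContinuousOn (fun z => (μ • ContinuousLinearMap.id ℂ 𝔸)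
      ((z * g z) • resolvent B z)) (triangleBoundary a b c) :=
    (ContinuousLinearMap.continuous _).comp_continuousOn hzR
  have key : Set.EqOn (fun z => ((1 + μ * z) * g z) • resolvent B z)
      (fun z => g z • resolvent B z + (μ • ContinuousLinearMap.id ℂ 𝔸)
        ((z * g z) • resolvent B z)) (triangleBoundary a b c) := by
    intro z _
    simp only [smul_apply, ContinuousLinearMap.id_apply]
    module
  rw [triangleIntegral_congr key, triangleIntegral_add hR hμ, triangleIntegral_clm_comp _ hzR,
    triangleIntegral_mul_smul_resolvent hB hg hg0]
  simp [mul_add]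

/-- The holomorphic calculus sends the Cayley factor `(1 - μ z) / (1 + μ z)` to `V`. -/
lemma triangleIntegral_mul_cayley_smul_resolvent {B V : 𝔸} {g : ℂ → ℂ} {μ : ℂ} {s : Set ℂ}
    (hs : Convex ℝ s) (hso : IsOpen s) (ha : a ∈ s) (hb : b ∈ s) (hc : c ∈ s)
    (hB : triangleBoundary a b c ⊆ resolventSet ℂ B) (hg : DifferentiableOn ℂ g s)
    (hμ : ∀ z ∈ s, 1 + μ * z ≠ 0) (hV : (1 + μ • B) * V = 1 - μ • B) :
    triangleIntegral (fun z => (g z * ((1 - μ * z) / (1 + μ * z))) • resolvent B z) a b c =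
      triangleIntegral (fun z => g z • resolvent B z) a b c * V := by
  have hsub := triangleBoundary_subset hs ha hb hc
  set h : ℂ → ℂ := fun z => g z / (1 + μ * z) with hh
  have hd : DifferentiableOn ℂ h s := hg.div (by fun_prop) hμ
  have hcont := hd.continuousOn.mono hsub
  have h0 := triangleIntegral_eq_zero_of_differentiableOn hs hso hd ha hb hc
  have hplus := triangleIntegral_one_add_mul_smul_resolvent μ hB hcont h0
  have hminus := triangleIntegral_one_add_mul_smul_resolvent (-μ) hB hcont h0
  have e1 : triangleIntegral (fun z => g z • resolvent B z) a b c =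
      triangleIntegral (fun z => ((1 + μ * z) * h z) • resolvent B z) a b c :=
    triangleIntegral_congr fun z hz => by
      simp only [hh, mul_div_cancel₀ _ (hμ z (hsub hz))]
  have e2 : triangleIntegral (fun z => (g z * ((1 - μ * z) / (1 + μ * z))) • resolvent B z) a b c =
      triangleIntegral (fun z => ((1 + -μ * z) * h z) • resolvent B z) a b c :=
    triangleIntegral_congr fun z hz => by
      simp only [hh]
      congr 1
      ring
  rw [e1, e2, hplus, hminus, mul_assoc, hV, neg_smul, sub_eq_add_neg]

/-- The holomorphic calculus of `z ^ α` times a product of Cayley factors. -/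
lemma triangleIntegral_prod_cayley_smul_resolvent {B : 𝔸} {κ : ℂ} {s : Set ℂ} {ω : ℕ → ℂ}
    {V : ℕ → 𝔸} (hs : Convex ℝ s) (hso : IsOpen s) (ha : a ∈ s) (hb : b ∈ s) (hc : c ∈ s)
    (hB : triangleBoundary a b c ⊆ resolventSet ℂ B)
    (hκ : triangleIntegral (resolvent B) a b c = κ • (1 : 𝔸))
    (hω : ∀ k, ∀ z ∈ s, 1 + ω k * z ≠ 0) (hV : ∀ k, (1 + ω k • B) * V k = 1 - ω k • B)
    (n α : ℕ) :
    triangleIntegral (fun z => (z ^ α * ∏ k ∈ Finset.range n, (1 - ω k * z) / (1 + ω k * z)) •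
      resolvent B z) a b c = κ • (((List.range n).map V).prod * B ^ α) := by
  have hsub := triangleBoundary_subset hs ha hb hc
  have hd (n : ℕ) : DifferentiableOn ℂ
      (fun z => ∏ k ∈ Finset.range n, (1 - ω k * z) / (1 + ω k * z)) s :=
    DifferentiableOn.fun_finsetProd fun k _ =>
      DifferentiableOn.div (by fun_prop) (by fun_prop) (hω k)
  induction α with
  | zero =>
    simp only [pow_zero, one_mul, mul_one]
    induction n with
    | zero => simpa using hκ
    | succ n ih =>
      simp only [Finset.prod_range_succ]
      rw [triangleIntegral_mul_cayley_smul_resolvent hs hso ha hb hc hB (hd n) (hω n) (hV n), ih,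
        List.range_succ]
      simp
  | succ α ih =>
    have hg : DifferentiableOn ℂ
        (fun z => z ^ α * ∏ k ∈ Finset.range n, (1 - ω k * z) / (1 + ω k * z)) s :=
      (differentiableOn_pow α).mul (hd n)
    have := triangleIntegral_mul_smul_resolvent hB (hg.continuousOn.mono hsub)
      (triangleIntegral_eq_zero_of_differentiableOn hs hso hg ha hb hc)
    rw [ih] at this
    simp only [← mul_assoc, ← pow_succ'] at this
    rw [this, smul_mul_assoc, mul_assoc, ← pow_succ]

end Calculus

section Estimates

lemma integral_exp_neg_mul_le {k : ℝ} (hk : 0 < k) :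
    ∫ t in (0 : ℝ)..1, Real.exp (-(k * t)) ≤ 1 / k := by
  have hderiv (t : ℝ) : HasDerivAt (fun t => -(Real.exp (-(k * t)) / k)) (Real.exp (-(k * t))) t := by
    have h := ((((hasDerivAt_id t).const_mul k).neg.exp).div_const k).neg
    convert! h using 1
    simp only [id, Pi.neg_apply]
    field_simp
  rw [intervalIntegral.integral_eq_sub_of_hasDerivAt (fun t _ => hderiv t)
    (by apply Continuous.intervalIntegrable; fun_prop)]
  have := Real.exp_pos (-(k * 1))
  have : 0 < Real.exp (-(k * 1)) / k := by positivity
  simp only [mul_zero, neg_zero, Real.exp_zero]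
  linarith

lemma norm_segmentIntegral_le_of_exp {E : Type*} [NormedAddCommGroup E] [NormedSpace ℂ E]
    {f : ℂ → E} {p q : ℂ} {M k : ℝ} (hM : 0 ≤ M) (hk : 0 < k)
    (h : ∀ t ∈ Set.Icc (0 : ℝ) 1, ‖f (p + t • (q - p))‖ ≤ M * Real.exp (-(k * t))) :
    ‖segmentIntegral f p q‖ ≤ ‖q - p‖ * (M * (1 / k)) := by
  refine (intervalIntegral.norm_integral_le_of_norm_le zero_le_one
    (g := fun t => ‖q - p‖ * (M * Real.exp (-(k * t)))) (.of_forall fun t ht => ?_)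
    (by apply Continuous.intervalIntegrable; fun_prop)).trans ?_
  · rw [norm_smul]
    exact mul_le_mul_of_nonneg_left (h t ⟨ht.1.le, ht.2⟩) (norm_nonneg _)
  · rw [intervalIntegral.integral_const_mul, intervalIntegral.integral_const_mul]
    gcongr
    exact integral_exp_neg_mul_le hk

lemma im_segmentIntegral_inv {p q : ℂ} (h0 : (0 : ℂ) ∉ segment ℝ p q) :
    (segmentIntegral (fun z => z⁻¹) p q).im =
      (q.im * p.re - q.re * p.im) *
        ∫ t in (0 : ℝ)..1, (Complex.normSq (p + t • (q - p)))⁻¹ := by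
  have hinv : ContinuousOn (fun z : ℂ => z⁻¹) (segment ℝ p q) :=
    continuousOn_inv₀.mono fun z hz h => h0 (h ▸ hz)
  have h := Complex.imCLM.intervalIntegral_comp_comm (intervalIntegrable_segment hinv)
  rw [segmentIntegral, ← Complex.imCLM_apply, ← h, ← intervalIntegral.integral_const_mul]
  refine intervalIntegral.integral_congr fun t _ => ?_
  simp [Complex.inv_im, Complex.inv_re]
  ring

lemma inv_sq_le_integral_inv_normSq {p q : ℂ} {Z : ℝ} (h0 : (0 : ℂ) ∉ segment ℝ p q)
    (hZ : ∀ z ∈ segment ℝ p q, ‖z‖ ≤ Z) :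
    (Z ^ 2)⁻¹ ≤ ∫ t in (0 : ℝ)..1, (Complex.normSq (p + t • (q - p)))⁻¹ := by
  have hne : ∀ z ∈ segment ℝ p q, Complex.normSq z ≠ 0 := fun z hz h =>
    h0 (Complex.normSq_eq_zero.1 h ▸ hz)
  have hcont : ContinuousOn (fun z : ℂ => (Complex.normSq z)⁻¹) (segment ℝ p q) :=
    Complex.continuous_normSq.continuousOn.inv₀ hne
  have := intervalIntegral.integral_mono_on (a := 0) (b := 1) (f := fun _ => (Z ^ 2)⁻¹) zero_le_one
    (intervalIntegrable_const (μ := MeasureTheory.volume))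
    ((continuousOn_comp_segment hcont).intervalIntegrable_of_Icc zero_le_one)
    fun t ht => by
      have hmem := add_smul_sub_mem_segment p q ht
      have h1 : 0 < Complex.normSq (p + t • (q - p)) :=
        (Complex.normSq_nonneg _).lt_of_ne (hne _ hmem).symm
      refine inv_anti₀ h1 ?_
      rw [Complex.normSq_eq_norm_sq]
      exact pow_le_pow_left₀ (norm_nonneg _) (hZ _ hmem) 2
  simpa using this

lemma norm_cayley_le {ω ωmin ωmax d Z : ℝ} {z : ℂ} (hωmin : 0 < ωmin) (h1 : ωmin ≤ ω)
    (h2 : ω ≤ ωmax) (hd : ωmax * d ≤ 1 / 2) (hd0 : 0 ≤ d) (hz : -d ≤ z.re) (hZ : ‖z‖ ≤ Z) :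
    ‖(1 - (ω : ℂ) * z) / (1 + (ω : ℂ) * z)‖ ≤
      Real.exp (8 * ωmax * d - 2 * ωmin / (1 + ωmax * Z) ^ 2 * z.re) := by
  have hω : 0 < ω := hωmin.trans_le h1
  have hmax : 0 < ωmax := hω.trans_le h2
  have hZ0 : 0 ≤ Z := (norm_nonneg z).trans hZ
  set N := Complex.normSq (1 + (ω : ℂ) * z) with hN
  have hNlow : 1 / 4 ≤ N := by
    have hre : 1 / 2 ≤ (1 + (ω : ℂ) * z).re := by
      simp only [Complex.add_re, Complex.one_re, Complex.re_ofReal_mul]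
      nlinarith
    have := Complex.re_sq_le_normSq (1 + (ω : ℂ) * z)
    nlinarith
  have hNup : N ≤ (1 + ωmax * Z) ^ 2 := by
    rw [hN, Complex.normSq_eq_norm_sq]
    refine pow_le_pow_left₀ (norm_nonneg _) ((norm_add_le _ _).trans ?_) 2
    rw [norm_mul, norm_one, Complex.norm_real, Real.norm_of_nonneg hω.le]
    gcongr
  have hN0 : 0 < N := by linarith
  have hsq : ‖(1 - (ω : ℂ) * z) / (1 + (ω : ℂ) * z)‖ ^ 2 = 1 - 4 * ω * z.re / N := by
    rw [norm_div, div_pow, ← Complex.normSq_eq_norm_sq, ← Complex.normSq_eq_norm_sq, ← hN,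
      eq_sub_iff_add_eq, ← add_div, div_eq_one_iff_eq hN0.ne', hN]
    simp [Complex.normSq_apply]
    ring
  have hexp : ‖(1 - (ω : ℂ) * z) / (1 + (ω : ℂ) * z)‖ ≤ Real.exp (-(2 * ω * z.re / N)) := by
    refine le_of_sq_le_sq ?_ (Real.exp_pos _).le
    rw [hsq, ← Real.exp_nat_mul]
    have := Real.add_one_le_exp (-(4 * ω * z.re / N))
    refine (le_of_eq ?_).trans (this.trans_eq ?_)
    · ring
    · congr 1
      push_cast
      ring
  refine hexp.trans (Real.exp_le_exp.2 ?_)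
  have hD : 0 < (1 + ωmax * Z) ^ 2 := by positivity
  rcases le_total 0 z.re with hre | hre
  · have : 2 * ωmin / (1 + ωmax * Z) ^ 2 * z.re ≤ 2 * ω * z.re / N := by
      rw [div_mul_eq_mul_div]
      gcongr
    have : 0 ≤ 8 * ωmax * d := by positivity
    linarith
  · have h3 : 0 ≤ 2 * ωmin / (1 + ωmax * Z) ^ 2 * (-z.re) :=
      mul_nonneg (by positivity) (by linarith)
    have h4 : 2 * ω * (-z.re) / N ≤ 8 * ωmax * d := by
      rw [div_le_iff₀ hN0]
      have : ω * (-z.re) ≤ ωmax * d := by nlinarith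
      have : ωmax * d * (1 / 4) ≤ ωmax * d * N := by gcongr
      linarith
    have : -(2 * ω * z.re / N) = 2 * ω * (-z.re) / N := by ring
    linarith

end Estimates

section Sectorial

lemma IsResolventAt.sub_eq {A : X →ₗ.[ℂ] X} {lam μ : ℂ} {R S : X →L[ℂ] X}
    (hR : IsResolventAt A lam R) (hS : IsResolventAt A μ S) :
    R - S = (μ - lam) • (S * R) := by
  ext x
  obtain ⟨hx, hAx⟩ := hR.1 x
  have h := hS.2 ⟨R x, hx⟩
  rw [← eq_sub_iff_add_eq'] at hAx
  rw [hAx] at h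
  simp only [map_add, map_sub, map_smul] at h
  change R x - S x = (μ - lam) • S (R x)
  nth_rewrite 1 [← h]
  module

lemma closure_sector_subset {θ : ℝ} (h1 : θ < Real.pi / 2) :
    closure (sector θ) ⊆ {z : ℂ | |z.im| ≤ Real.tan θ * z.re} := by
  refine closure_minimal (fun z hz => ?_) (isClosed_le (by fun_prop) (by fun_prop))
  obtain ⟨hz0, harg⟩ := hz
  have hre : 0 < z.re := by
    rcases Complex.abs_arg_lt_pi_div_two_iff.1 (harg.trans h1) with h | h
    · exact h
    · exact absurd h hz0
  obtain ⟨hl, hu⟩ := abs_lt.1 harg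
  have hu' := Real.tan_lt_tan_of_lt_of_lt_pi_div_two (by linarith) h1 hu
  have hl' := Real.tan_lt_tan_of_lt_of_lt_pi_div_two (by linarith) (by linarith) hl
  rw [Real.tan_neg, Complex.tan_arg] at hl'
  rw [Complex.tan_arg] at hu'
  rw [div_lt_iff₀ hre] at hu'
  rw [lt_div_iff₀ hre] at hl'
  exact abs_le.2 ⟨by linarith, hu'.le⟩

lemma sector_mono {θ θ' : ℝ} (h : θ ≤ θ') : sector θ ⊆ sector θ' :=
  fun _ hz => ⟨hz.1, hz.2.trans_le h⟩

/-- The bounded inverse of a sectorial operator is sectorial. -/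
lemma IsSectorialOfAngle.exists_resolvent_inverse_bound {A : X →ₗ.[ℂ] X} {θ : ℝ} (hθ0 : 0 < θ)
    (hθ : θ < Real.pi / 2) (hA : IsSectorialOfAngle A θ) {B : X →L[ℂ] X}
    (hB : IsResolventAt A 0 B) :
    ∃ m C : ℝ, 1 ≤ m ∧ 0 < C ∧ ∀ σ ∈ Set.Icc (0 : ℝ) 1, ∀ z : ℂ, m * z.re < |z.im| →
      z ∈ resolventSet ℂ (σ • B) ∧ ‖resolvent (σ • B) z‖ ≤ C / ‖z‖ := by
  have hpi := Real.pi_pos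
  set θ' := (θ + Real.pi / 2) / 2 with hθ'
  have hlt : θ < θ' := by linarith
  have hlt' : θ' < Real.pi / 2 := by linarith
  have htan : 0 < Real.tan θ' := Real.tan_pos_of_pos_of_lt_pi_div_two (by linarith) hlt'
  obtain ⟨C, hC⟩ := hA.2 θ' hlt (by linarith)
  refine ⟨max 1 (Real.tan θ'), 1 + max C 0, le_max_left _ _, by positivity,
    fun σ hσ z hz => ?_⟩
  have hz0 : z ≠ 0 := by
    rintro rfl
    simp at hz
  have htanz : Real.tan θ' * z.re < |z.im| := by
    rcases le_total 0 z.re with hre | hre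
    · exact (mul_le_mul_of_nonneg_right (le_max_right _ _) hre).trans_lt hz
    · refine lt_of_le_of_ne ((mul_nonpos_of_nonneg_of_nonpos htan.le hre).trans (abs_nonneg _))
        fun h => hz0 ?_
      have h1 : |z.im| = 0 := le_antisymm
        (h ▸ mul_nonpos_of_nonneg_of_nonpos htan.le hre) (abs_nonneg _)
      have h2 : z.re = 0 := by
        rw [h1] at h
        exact (mul_eq_zero.1 h).resolve_left htan.ne'
      exact Complex.ext h2 (abs_eq_zero.1 h1)
  suffices ∃ S : X →L[ℂ] X, (1 - ((σ : ℂ) * z⁻¹) • B) * S = 1 ∧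
      S * (1 - ((σ : ℂ) * z⁻¹) • B) = 1 ∧ ‖S‖ ≤ 1 + max C 0 by
    obtain ⟨S, hS1, hS2, hS⟩ := this
    have hfac : algebraMap ℂ (X →L[ℂ] X) z - σ • B = z • (1 - ((σ : ℂ) * z⁻¹) • B) := by
      rw [Algebra.algebraMap_eq_smul_one, smul_sub, smul_smul, mul_comm (σ : ℂ),
        mul_inv_cancel_left₀ hz0, Complex.coe_smul]
    have h1 : (algebraMap ℂ (X →L[ℂ] X) z - σ • B) * (z⁻¹ • S) = 1 := by
      rw [hfac, smul_mul_smul_comm, mul_inv_cancel₀ hz0, hS1, one_smul]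
    have h2 : (z⁻¹ • S) * (algebraMap ℂ (X →L[ℂ] X) z - σ • B) = 1 := by
      rw [hfac, smul_mul_smul_comm, inv_mul_cancel₀ hz0, hS2, one_smul]
    have hmem : z ∈ resolventSet ℂ (σ • B) :=
      spectrum.mem_resolventSet_of_left_right_inverse h1 h2
    refine ⟨hmem, ?_⟩
    have : resolvent (σ • B) z = z⁻¹ • S := by
      rw [← mul_one (resolvent (σ • B) z), ← h1, ← mul_assoc, resolvent_mul_sub hmem, one_mul]
    rw [this, norm_smul, norm_inv, div_eq_inv_mul]
    gcongr
  rcases hσ.1.eq_or_lt with rfl | hσ0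
  · refine ⟨1, by simp, by simp, ContinuousLinearMap.norm_id_le.trans ?_⟩
    simp
  · set lam : ℂ := (σ : ℂ) * z⁻¹ with hlam
    have hnot : lam ∉ closure (sector θ') := by
      intro hmem
      have h := closure_sector_subset hlt' hmem
      have hn : 0 < Complex.normSq z := Complex.normSq_pos.2 hz0
      simp only [Set.mem_ofPred_eq, hlam, Complex.re_ofReal_mul, Complex.im_ofReal_mul,
        Complex.inv_re, Complex.inv_im, abs_mul, abs_div, abs_neg, abs_of_pos hσ0,
        abs_of_pos hn] at h
      have h' : σ / Complex.normSq z * |z.im| ≤ σ / Complex.normSq z * (Real.tan θ' * z.re) := by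
        calc _ = σ * (|z.im| / Complex.normSq z) := by ring
          _ ≤ _ := h
          _ = _ := by ring
      exact absurd (le_of_mul_le_mul_left h' (by positivity)) (not_le.2 htanz)
    obtain ⟨R, hR⟩ := hA.1 lam fun h => hnot (closure_mono (sector_mono hlt.le) h)
    have e1 := hR.sub_eq hB
    have e2 := hB.sub_eq hR
    refine ⟨1 + lam • R, ?_, ?_, ?_⟩
    · have : (1 - lam • B) * (1 + lam • R) =
          1 + lam • (R - B - (0 - -lam) • (B * R)) := by
        simp only [sub_mul, mul_add, mul_one, one_mul, smul_mul_assoc, mul_smul_comm]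
        module
      rw [this, e1]
      simp
    · have : (1 + lam • R) * (1 - lam • B) =
          1 - lam • (B - R - (-lam - 0) • (R * B)) := by
        simp only [mul_sub, add_mul, mul_one, one_mul, smul_mul_assoc, mul_smul_comm]
        module
      rw [this, e2]
      simp
    · exact norm_add_le_of_le ContinuousLinearMap.norm_id_le
        ((hC lam hnot R hR).trans (le_max_left _ _))

lemma IsResolventAt.one_add_smul_mul_cayley {A : X →ₗ.[ℂ] X} {ω : ℂ} {B R : X →L[ℂ] X}
    (hB : IsResolventAt A 0 B) (hR : IsResolventAt A ω R) :
    (1 + ω • B) * (1 - (2 * ω) • R) = 1 - ω • B := by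
  have h := hR.sub_eq hB
  have : (1 + ω • B) * (1 - (2 * ω) • R) =
      1 - ω • B - (2 * ω) • (R - B - (0 - ω) • (B * R)) := by
    simp only [mul_sub, add_mul, mul_one, one_mul, smul_mul_assoc, mul_smul_comm]
    module
  rw [this, h]
  simp

lemma resolvent_of_norm_add_one_le [CompleteSpace X] {B : X →L[ℂ] X} {z : ℂ}
    (hz : ‖B‖ + 1 ≤ ‖z‖) : z ∈ resolventSet ℂ B ∧ ‖resolvent B z‖ ≤ 1 := by
  have h1 : ‖(1 : X →L[ℂ] X)‖ ≤ 1 := ContinuousLinearMap.norm_id_le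
  have hmem : z ∈ resolventSet ℂ B := by
    refine spectrum.mem_resolventSet_of_norm_lt_mul ?_
    have := mul_le_mul_of_nonneg_left h1 (norm_nonneg B)
    linarith
  refine ⟨hmem, ?_⟩
  have h := sub_mul_resolvent hmem
  rw [sub_mul, ← Algebra.smul_def, sub_eq_iff_eq_add] at h
  have h2 : ‖z‖ * ‖resolvent B z‖ ≤ 1 + ‖B‖ * ‖resolvent B z‖ := by
    rw [← norm_smul, h]
    exact norm_add_le_of_le h1 (norm_mul_le _ _)
  have := mul_le_mul_of_nonneg_right hz (norm_nonneg (resolvent B z))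
  linarith

end Sectorial

section Triangle

/-- The sides of the isosceles triangle with apex `-d`, height `L` and slope `m`. -/
lemma mem_triangleBoundary_isosceles {d m L : ℝ} (hL : 0 ≤ L) (hm : 0 ≤ m) {z : ℂ}
    (hz : z ∈ triangleBoundary ⟨-d, 0⟩ ⟨L - d, -(m * L)⟩ ⟨L - d, m * L⟩) :
    -d ≤ z.re ∧ z.re ≤ L - d ∧ |z.im| ≤ m * (z.re + d) ∧
      (|z.im| = m * (z.re + d) ∨ z.re = L - d) := by
  simp only [triangleBoundary, Set.mem_union, segment_eq_image', Set.mem_image] at hz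
  have hmL : 0 ≤ m * L := mul_nonneg hm hL
  rcases hz with (⟨t, ht, rfl⟩ | ⟨t, ht, rfl⟩) | ⟨t, ht, rfl⟩
  · have h1 : 0 ≤ t * L := mul_nonneg ht.1 hL
    have h2 : t * L ≤ L := mul_le_of_le_one_left hL ht.2
    have h3 : |t * (m * L)| = m * (t * L) := by
      rw [abs_of_nonneg (mul_nonneg ht.1 hmL)]; ring
    refine ⟨?_, ?_, ?_, Or.inl ?_⟩ <;> simp [-abs_mul, h1, h2, h3]
  · have h3 : |-(m * L) + t * (m * L + m * L)| ≤ m * L :=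
      abs_le.2 ⟨by nlinarith [ht.1], by nlinarith [ht.2]⟩
    refine ⟨?_, ?_, ?_, Or.inr ?_⟩ <;> simp [h3, hL]
  · have h1 : 0 ≤ t * L := mul_nonneg ht.1 hL
    have h2 : t * L ≤ L := mul_le_of_le_one_left hL ht.2
    have h3 : |t * (m * L)| = m * (t * L) := by
      rw [abs_of_nonneg (mul_nonneg ht.1 hmL)]; ring
    refine ⟨?_, ?_, ?_, Or.inl ?_⟩ <;> simp [-abs_mul, h1, h2, h3]

/-- A lower bound for the winding integral of the isosceles triangle around `0`. -/
lemma le_norm_triangleIntegral_inv {d m L Z : ℝ} (hd : 0 ≤ d) (hm : 0 ≤ m) (hL : 1 ≤ L - d)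
    (h0 : (0 : ℂ) ∉ triangleBoundary ⟨-d, 0⟩ ⟨L - d, -(m * L)⟩ ⟨L - d, m * L⟩)
    (hZ : ∀ z ∈ triangleBoundary ⟨-d, 0⟩ ⟨L - d, -(m * L)⟩ ⟨L - d, m * L⟩, ‖z‖ ≤ Z) :
    2 * m * L * (Z ^ 2)⁻¹ ≤
      ‖triangleIntegral (fun z => z⁻¹) ⟨-d, 0⟩ ⟨L - d, -(m * L)⟩ ⟨L - d, m * L⟩‖ := by
  refine le_trans ?_ ((le_abs_self _).trans (Complex.abs_im_le_norm _))
  have hab := fun h => h0 (Or.inl (Or.inl h))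
  have hbc := fun h => h0 (Or.inl (Or.inr h))
  have hac := fun h => h0 (Or.inr h)
  have iab := inv_sq_le_integral_inv_normSq hab fun z hz => hZ z (Or.inl (Or.inl hz))
  have ibc := inv_sq_le_integral_inv_normSq hbc fun z hz => hZ z (Or.inl (Or.inr hz))
  have iac := inv_sq_le_integral_inv_normSq hac fun z hz => hZ z (Or.inr hz)
  rw [triangleIntegral, Complex.sub_im, Complex.add_im, im_segmentIntegral_inv hab,
    im_segmentIntegral_inv hbc, im_segmentIntegral_inv hac]
  have hpos : 0 ≤ (Z ^ 2)⁻¹ := by positivity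
  have hL0 : 0 ≤ L := by linarith
  have hcross : 0 ≤ m * L * d := by positivity
  have h1 := mul_nonneg hcross (hpos.trans iab)
  have h2 := mul_nonneg hcross (hpos.trans iac)
  have h3 : 2 * m * L * (Z ^ 2)⁻¹ ≤ 2 * m * L * (L - d) * ∫ t in (0 : ℝ)..1,
      (Complex.normSq ((⟨L - d, -(m * L)⟩ : ℂ) +
        t • ((⟨L - d, m * L⟩ : ℂ) - ⟨L - d, -(m * L)⟩)))⁻¹ := by
    refine mul_le_mul ?_ ibc hpos ?_
    · exact le_mul_of_one_le_right (by positivity) hL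
    · have : 0 ≤ L - d := by linarith
      positivity
  linarith

end Triangle

section Decay

lemma norm_pow_mul_prod_cayley_le {ωmin ωmax Z m : ℝ} (hωmin : 0 < ωmin) (hω : ωmin ≤ ωmax)
    (hm : 0 ≤ m) (hZ0 : 0 ≤ Z) (α : ℕ) :
    ∃ K k : ℝ, 0 < K ∧ 0 < k ∧ ∀ n : ℕ, 1 ≤ n → ∀ ω : ℕ → ℝ,
      (∀ j, ωmin ≤ ω j ∧ ω j ≤ ωmax) → ∀ z : ℂ, -(1 / (2 * ωmax) / n) ≤ z.re → ‖z‖ ≤ Z →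
      ‖z‖ ≤ (1 + m) * (z.re + 2 * (1 / (2 * ωmax) / n)) →
      ‖z ^ α * ∏ j ∈ Finset.range n, (1 - (ω j : ℂ) * z) / (1 + (ω j : ℂ) * z)‖ ≤
        K / (n : ℝ) ^ α * Real.exp (-(k * n * (z.re + 1 / (2 * ωmax) / n))) := by
  have hmax : 0 < ωmax := hωmin.trans_le hω
  set c := 2 * ωmin / (1 + ωmax * Z) ^ 2 with hc
  have hc0 : 0 < c := by positivity
  set δ := 1 / (2 * ωmax) with hδ
  have hδ0 : 0 < δ := by positivity
  have hωδ : ωmax * δ = 1 / 2 := by rw [hδ]; field_simp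
  refine ⟨(1 + m) ^ α * (α.factorial * (2 / c) ^ α) * Real.exp (4 + 3 / 2 * (c * δ)), c / 2,
    by positivity, by positivity, fun n hn ω hωj z hre hz hz' => ?_⟩
  have hn0 : (0 : ℝ) < n := by exact_mod_cast hn
  have hn1 : (1 : ℝ) ≤ n := by exact_mod_cast hn
  have hd : ωmax * (δ / n) ≤ 1 / 2 := by
    rw [← mul_div_assoc, hωδ]
    exact div_le_self (by norm_num) hn1
  have hprod : ‖∏ j ∈ Finset.range n, (1 - (ω j : ℂ) * z) / (1 + (ω j : ℂ) * z)‖ ≤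
      Real.exp (4 - c * n * z.re) := by
    rw [norm_prod]
    calc _ ≤ ∏ j ∈ Finset.range n, Real.exp (8 * ωmax * (δ / n) - c * z.re) :=
          Finset.prod_le_prod (fun _ _ => norm_nonneg _) fun j _ =>
            norm_cayley_le hωmin (hωj j).1 (hωj j).2 hd (by positivity) hre hz
      _ = Real.exp (4 - c * n * z.re) := by
          rw [Finset.prod_const, Finset.card_range, ← Real.exp_nat_mul]
          congr 1
          have : (n : ℝ) * (8 * ωmax * (δ / n) - c * z.re) =
              8 * (ωmax * δ) - c * n * z.re := by field_simp
          rw [this, hωδ]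
          norm_num
  set y := n * (z.re + 2 * (δ / n)) with hy
  have hy0 : 0 ≤ y := mul_nonneg hn0.le (by linarith [div_pos hδ0 hn0])
  have hyδ : y = n * z.re + 2 * δ := by rw [hy]; field_simp
  have hpow : y ^ α ≤ α.factorial * (2 / c) ^ α * Real.exp (c / 2 * y) := by
    have h := Real.pow_div_factorial_le_exp (c / 2 * y) (by positivity) α
    rw [div_le_iff₀ (by positivity)] at h
    calc y ^ α = (2 / c) ^ α * (c / 2 * y) ^ α := by
          rw [← mul_pow]; congr 1; field_simp
      _ ≤ (2 / c) ^ α * (Real.exp (c / 2 * y) * α.factorial) := by gcongr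
      _ = _ := by ring
  have hzpow : ‖z ^ α‖ ≤ (1 + m) ^ α * (y ^ α / (n : ℝ) ^ α) := by
    rw [norm_pow, ← div_pow, ← mul_pow]
    refine pow_le_pow_left₀ (norm_nonneg _) (hz'.trans_eq ?_) α
    rw [hy, mul_div_cancel_left₀ _ hn0.ne']
  rw [norm_mul]
  calc _ ≤ (1 + m) ^ α * (α.factorial * (2 / c) ^ α * Real.exp (c / 2 * y) / (n : ℝ) ^ α) *
        Real.exp (4 - c * n * z.re) := by
        refine mul_le_mul (hzpow.trans ?_) hprod (norm_nonneg _) (by positivity)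
        gcongr
    _ = (1 + m) ^ α * (α.factorial * (2 / c) ^ α) / (n : ℝ) ^ α *
        (Real.exp (c / 2 * y) * Real.exp (4 - c * n * z.re)) := by ring
    _ = (1 + m) ^ α * (α.factorial * (2 / c) ^ α) / (n : ℝ) ^ α *
        (Real.exp (4 + 3 / 2 * (c * δ)) *
          Real.exp (-(c / 2 * n * (z.re + δ / n)))) := by
        rw [← Real.exp_add, ← Real.exp_add, hyδ]
        congr 2
        field_simp
        ring
    _ = _ := by ring

/-- Decay of products of Cayley factors of a bounded operator that is sectorial of angle smaller
than `π / 2`. -/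
lemma exists_norm_prod_cayley_mul_pow_le [CompleteSpace X] {B : X →L[ℂ] X} {m C ωmin ωmax : ℝ}
    (hm : 1 ≤ m) (hC : 0 < C)
    (hB : ∀ σ ∈ Set.Icc (0 : ℝ) 1, ∀ z : ℂ, m * z.re < |z.im| →
      z ∈ resolventSet ℂ (σ • B) ∧ ‖resolvent (σ • B) z‖ ≤ C / ‖z‖)
    (hωmin : 0 < ωmin) (hω : ωmin ≤ ωmax) (α : ℕ) :
    ∃ M : ℝ, 0 < M ∧ ∀ n : ℕ, 1 ≤ n → ∀ ω : ℕ → ℝ, (∀ k, ωmin ≤ ω k ∧ ω k ≤ ωmax) →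
      ∀ V : ℕ → X →L[ℂ] X,
        (∀ k, (1 + ((ω k : ℝ) : ℂ) • B) * V k = 1 - ((ω k : ℝ) : ℂ) • B) →
        ‖((List.range n).map V).prod * B ^ α‖ ≤ M / (n : ℝ) ^ α := by
  have hmax : 0 < ωmax := hωmin.trans_le hω
  have hm0 : 0 < m := by linarith
  set δ := 1 / (2 * ωmax) with hδ
  have hδ0 : 0 < δ := by positivity
  have hωδ : ωmax * δ = 1 / 2 := by rw [hδ]; field_simp
  set L := ‖B‖ + 1 + δ with hL
  have hL0 : 0 < L := by positivity
  set Z := (1 + m) * L with hZ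
  have hZ0 : 0 < Z := by positivity
  obtain ⟨K, k, hK, hk, hbound⟩ :=
    norm_pow_mul_prod_cayley_le (Z := Z) (m := m) hωmin hω hm0.le hZ0.le α
  set κ₀ := 2 * m * L * (Z ^ 2)⁻¹ with hκ₀
  have hκ₀pos : 0 < κ₀ := by positivity
  refine ⟨(Z * (K * (2 * C / δ) * (1 / (k * L))) * 2 + K * (2 * m * L)) / κ₀, by positivity,
    fun n hn ω hωk V hV => ?_⟩
  have hn0 : (0 : ℝ) < n := by exact_mod_cast hn
  have hn1 : (1 : ℝ) ≤ n := by exact_mod_cast hn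
  set d := δ / n with hd
  have hd0 : 0 < d := by positivity
  have hdδ : d ≤ δ := div_le_self hδ0.le hn1
  set a : ℂ := ⟨-d, 0⟩ with ha
  set b : ℂ := ⟨L - d, -(m * L)⟩ with hb
  set c : ℂ := ⟨L - d, m * L⟩ with hc
  have hgeom : ∀ z ∈ triangleBoundary a b c, -d ≤ z.re ∧ z.re ≤ L - d ∧
      |z.im| ≤ m * (z.re + d) ∧ (|z.im| = m * (z.re + d) ∨ z.re = L - d) :=
    fun z hz => mem_triangleBoundary_isosceles hL0.le hm0.le hz
  have hnorm : ∀ z ∈ triangleBoundary a b c, ‖z‖ ≤ (1 + m) * (z.re + 2 * d) := by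
    intro z hz
    obtain ⟨h1, h2, h3, -⟩ := hgeom z hz
    have h4 := Complex.norm_le_abs_re_add_abs_im z
    have h5 : |z.re| ≤ z.re + 2 * d := abs_le.2 ⟨by linarith, by linarith⟩
    nlinarith
  have hnormZ : ∀ z ∈ triangleBoundary a b c, ‖z‖ ≤ Z := by
    intro z hz
    obtain ⟨h1, h2, h3, -⟩ := hgeom z hz
    have h4 := Complex.norm_le_abs_re_add_abs_im z
    have h5 : |z.re| ≤ L := abs_le.2 ⟨by linarith [norm_nonneg B], by linarith⟩
    have h6 : m * (z.re + d) ≤ m * L := by gcongr; linarith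
    rw [hZ]
    linarith
  have hside : ∀ σ ∈ Set.Icc (0 : ℝ) 1, ∀ z : ℂ, |z.im| = m * (z.re + d) →
      z ∈ resolventSet ℂ (σ • B) ∧ ‖resolvent (σ • B) z‖ ≤ 2 * C / d := by
    intro σ hσ z hz
    have hmd : 0 < m * d := by positivity
    obtain ⟨h1, h2⟩ := hB σ hσ z (by rw [hz]; linarith)
    refine ⟨h1, h2.trans ?_⟩
    have h3 : d ≤ 2 * ‖z‖ := by
      have h4 := (neg_le_abs z.re).trans (Complex.abs_re_le_norm z)
      have h5 := hz.symm.trans_le (Complex.abs_im_le_norm z)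
      have h6 : z.re + d ≤ ‖z‖ := by
        by_contra! hlt
        have : ‖z‖ < m * (z.re + d) :=
          hlt.trans_le (le_mul_of_one_le_left ((norm_nonneg z).trans hlt.le) hm)
        linarith
      linarith
    have h7 : 0 < ‖z‖ := by linarith
    rw [div_le_div_iff₀ h7 hd0]
    nlinarith
  have hfar : ∀ σ ∈ Set.Icc (0 : ℝ) 1, ∀ z : ℂ, z.re = L - d →
      z ∈ resolventSet ℂ (σ • B) ∧ ‖resolvent (σ • B) z‖ ≤ 1 := by
    intro σ hσ z hz
    refine resolvent_of_norm_add_one_le ?_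
    have h1 : ‖σ • B‖ ≤ ‖B‖ := by
      rw [norm_smul, Real.norm_of_nonneg hσ.1]
      exact mul_le_of_le_one_left (norm_nonneg _) hσ.2
    have h2 := Complex.re_le_norm z
    linarith
  have hres : ∀ σ ∈ Set.Icc (0 : ℝ) 1, ∀ z ∈ triangleBoundary a b c,
      z ∈ resolventSet ℂ (σ • B) ∧ ‖resolvent (σ • B) z‖ ≤ max (2 * C / d) 1 := by
    intro σ hσ z hz
    rcases (hgeom z hz).2.2.2 with h | h
    · exact (hside σ hσ z h).imp_right fun h' => h'.trans (le_max_left _ _)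
    · exact (hfar σ hσ z h).imp_right fun h' => h'.trans (le_max_right _ _)
  have h0 : (0 : ℂ) ∉ triangleBoundary a b c := by
    intro h
    rcases (hgeom 0 h).2.2.2 with h' | h'
    · have : 0 < m * d := by positivity
      simp at h'
      rcases h' with h' | h' <;> linarith
    · simp at h'
      linarith [norm_nonneg B]
  have hκ := triangleIntegral_resolvent h0 (fun σ hσ z hz => (hres σ hσ z hz).1)
    fun σ hσ z hz => (hres σ hσ z hz).2
  have hone : (1 : ℝ) ∈ Set.Icc (0 : ℝ) 1 := by simp
  set s : Set ℂ := {z | -(2 * δ) < z.re} with hs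
  have hpole : ∀ j, ∀ z ∈ s, 1 + ((ω j : ℝ) : ℂ) * z ≠ 0 := by
    intro j z hz h
    have hz' : -(2 * δ) < z.re := hz
    have hre := congrArg Complex.re h
    simp only [Complex.add_re, Complex.one_re, Complex.re_ofReal_mul, Complex.zero_re] at hre
    have hωj := hωk j
    have : 0 < ω j := hωmin.trans_le hωj.1
    nlinarith
  have hcalc := triangleIntegral_prod_cayley_smul_resolvent (ω := fun j => ((ω j : ℝ) : ℂ))
    (convex_halfSpace_re_gt _) (isOpen_lt continuous_const Complex.continuous_re)
    (show a ∈ s by simp [hs, ha]; linarith) (show b ∈ s by simp [hs, hb]; linarith [norm_nonneg B])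
    (show c ∈ s by simp [hs, hc]; linarith [norm_nonneg B])
    (fun z hz => by simpa using (hres 1 hone z hz).1) hκ hpole hV n α
  set F : ℂ → X →L[ℂ] X := fun z =>
    (z ^ α * ∏ j ∈ Finset.range n, (1 - ((ω j : ℝ) : ℂ) * z) / (1 + ((ω j : ℝ) : ℂ) * z)) •
      resolvent B z with hF
  have hFbound : ∀ z ∈ triangleBoundary a b c, ∀ r : ℝ, ‖resolvent B z‖ ≤ r →
      ‖F z‖ ≤ K / (n : ℝ) ^ α * Real.exp (-(k * n * (z.re + d))) * r := by
    intro z hz r hr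
    rw [hF, norm_smul]
    exact mul_le_mul (hbound n hn ω hωk z (hgeom z hz).1 (hnormZ z hz) (hnorm z hz)) hr
      (norm_nonneg _) (by positivity)
  have hray : ∀ q : ℂ, q.re = L - d → |q.im| = m * L →
      segment ℝ a q ⊆ triangleBoundary a b c →
      ‖segmentIntegral F a q‖ ≤ Z * (K * (2 * C / δ) * (1 / (k * L))) / (n : ℝ) ^ α := by
    intro q hqre hqim hsub
    have hqa : ‖q - a‖ ≤ Z := by
      refine (Complex.norm_le_abs_re_add_abs_im _).trans_eq ?_
      simp only [Complex.sub_re, Complex.sub_im, hqre, ha, sub_zero, hqim, hZ]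
      rw [sub_neg_eq_add, sub_add_cancel, abs_of_pos hL0]
      ring
    have h := norm_segmentIntegral_le_of_exp (f := F) (p := a) (q := q)
      (M := K / (n : ℝ) ^ α * (2 * C / d)) (k := k * n * L) (by positivity) (by positivity)
      fun t ht => by
        have hmem := hsub (add_smul_sub_mem_segment a q ht)
        have hre : (a + t • (q - a)).re + d = t * L := by
          simp [ha, hqre]
        have him : |(a + t • (q - a)).im| = m * ((a + t • (q - a)).re + d) := by
          rw [hre]
          simp [ha, abs_mul, hqim, abs_of_nonneg ht.1]
          ring
        have hr := (hside 1 hone _ him).2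
        rw [one_smul] at hr
        refine (hFbound _ hmem _ hr).trans_eq ?_
        rw [hre, show k * n * (t * L) = k * n * L * t by ring]
        ring
    refine h.trans ((mul_le_mul_of_nonneg_right hqa (by positivity)).trans_eq ?_)
    rw [hd]
    field_simp
  have hvert : ‖segmentIntegral F b c‖ ≤ K * (2 * m * L) / (n : ℝ) ^ α := by
    have h := norm_segmentIntegral_le (f := F) (p := b) (q := c) (M := K / (n : ℝ) ^ α)
      fun z hz => by
        have hmem : z ∈ triangleBoundary a b c := Or.inl (Or.inr hz)
        have hre : z.re = L - d := by
          rw [segment_eq_image'] at hz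
          obtain ⟨t, -, rfl⟩ := hz
          simp [hb, hc]
        have hr := (hfar 1 hone z hre).2
        rw [one_smul] at hr
        refine (hFbound z hmem 1 hr).trans ?_
        rw [mul_one]
        refine mul_le_of_le_one_right (by positivity) (Real.exp_le_one_iff.2 ?_)
        have : 0 ≤ z.re + d := by linarith
        have : 0 ≤ k * n * (z.re + d) := by positivity
        linarith
    have hcb : ‖c - b‖ ≤ 2 * m * L := by
      refine (Complex.norm_le_abs_re_add_abs_im _).trans_eq ?_
      simp only [Complex.sub_re, Complex.sub_im, hb, hc, sub_self, abs_zero, zero_add]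
      rw [sub_neg_eq_add, abs_of_nonneg (by positivity)]
      ring
    refine h.trans ((mul_le_mul_of_nonneg_left hcb (by positivity)).trans_eq ?_)
    ring
  have hab := hray b rfl (by rw [hb, abs_neg, abs_of_nonneg (by positivity)])
    fun z hz => Or.inl (Or.inl hz)
  have hac := hray c rfl (by rw [hc, abs_of_nonneg (by positivity)]) fun z hz => Or.inr hz
  have htotal := norm_sub_le_of_le (norm_add_le_of_le hab hvert) hac
  rw [← triangleIntegral, hcalc, norm_smul] at htotal
  have hκlow := le_norm_triangleIntegral_inv hd0.le hm0.le
    (show 1 ≤ L - d by linarith [norm_nonneg B]) h0 hnormZ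
  have := (mul_le_mul_of_nonneg_right hκlow (norm_nonneg _)).trans htotal
  rw [← hκ₀, mul_comm, ← le_div_iff₀ hκ₀pos] at this
  refine this.trans_eq ?_
  ring

end Decay

/-- Theorem 3.1 / Theorem A.1: if `A` is a densely defined closed sectorial operator of some
angle `θ < π/2` with `0 ∈ ρ(A)` on a Banach space, then for every nonnegative integer `α` and
every `0 < ω_min ≤ ω_max < ∞` there is `M > 0` with
`‖(∏_{k=1}^n V_{ω_k}(A)) A^{-α}‖ ≤ M n^{-α}` for all `n` and all `(ω_k) ∈ S(ω_min, ω_max)`.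
Here the Cayley transform `V_ω(A) = (A - ω)(A + ω)⁻¹` is expressed via the identity
`V_ω(A) = 1 - 2ω (ω + A)⁻¹`, the resolvent `(ω + A)⁻¹` being any operator `R k` with
`IsResolventAt A (ω k) (R k)`. -/
theorem cayley_product_decay_of_sectorial
    {X : Type*} [NormedAddCommGroup X] [NormedSpace ℂ X] [CompleteSpace X]
    (A : X →ₗ.[ℂ] X)
    (hdense : Dense (A.domain : Set X))
    (hclosed : IsClosed (A.graph : Set (X × X)))
    (hsect : ∃ θ : ℝ, 0 < θ ∧ θ < Real.pi / 2 ∧ IsSectorialOfAngle A θ)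
    (Ainv : X →L[ℂ] X) (hAinv : IsResolventAt A 0 Ainv)
    (α : ℕ) (ωmin ωmax : ℝ) (hωmin : 0 < ωmin) (hω : ωmin ≤ ωmax) :
    ∃ M : ℝ, 0 < M ∧ ∀ n : ℕ, 1 ≤ n → ∀ ω : ℕ → ℝ,
      (∀ k, ωmin ≤ ω k ∧ ω k ≤ ωmax) →
      ∀ R : ℕ → X →L[ℂ] X, (∀ k, IsResolventAt A ((ω k : ℝ) : ℂ) (R k)) →
        ‖((List.range n).map fun k => (1 : X →L[ℂ] X) - ((2 * ω k : ℝ) : ℂ) • R k).prod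
            * Ainv ^ α‖ ≤ M / (n : ℝ) ^ α := by
  obtain ⟨θ, hθ0, hθ, hA⟩ := hsect
  obtain ⟨m, C, hm, hC, hB⟩ := hA.exists_resolvent_inverse_bound hθ0 hθ hAinv
  obtain ⟨M, hM, h⟩ := exists_norm_prod_cayley_mul_pow_le hm hC hB hωmin hω α
  refine ⟨M, hM, fun n hn ω hωk R hR => h n hn ω hωk _ fun k => ?_⟩
  rw [Complex.ofReal_mul, Complex.ofReal_ofNat]
  exact hAinv.one_add_smul_mul_cayley (hR k)

end
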